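/- (Monotonicity of the joint response; Remark 1 generalized) Let M be a multi-agent MDP with n agents such that for every agent i and every fixed π_{-i} the projection Π_i(M,π_{-i}) has a unique optimal policy, and let σ be a permutation of {1,…,n}. Then for every joint policy π and every state s, V^{M, JR_σ(π)}(s) ≥ V^{M, π}(s); in particular for any agents i ≠ j, V^{M, BR_i(BR_j(π))}(s) ≥ V^{M, π}(s). -/

import Mathlib

open scoped ENNReal

/-- A (finite) Markov Decision Process with states `S`, actions `A`,
transition kernel `T`, reward `R` and discount factor `γ ∈ [0,1)`. -/
structure MDP (S A : Type) [Fintype S] [Nonempty S] [Fintype A] [Nonempty A] where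
  T : S → A → PMF S
  R : S → A → ℝ
  γ : ℝ
  γ_nonneg : 0 ≤ γ
  γ_lt_one : γ < 1

namespace MDP

variable {S A : Type} [Fintype S] [Nonempty S] [Fintype A] [Nonempty A]

/-- The distribution of the state at time `t` of the Markov chain induced by
policy `π`, started at `s₀`. -/
noncomputable def stateDist (M : MDP S A) (π : S → A) (s₀ : S) : ℕ → PMF S
  | 0 => PMF.pure s₀
  | t + 1 => (M.stateDist π s₀ t).bind fun s => M.T s (π s)

/-- The value of policy `π` at state `s₀`:
`V^{M,π}(s₀) = ∑_{t≥0} γ^t E[R(s_t, π(s_t))]`. -/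
noncomputable def V (M : MDP S A) (π : S → A) (s₀ : S) : ℝ :=
  ∑' t : ℕ, M.γ ^ t * ∑ s : S, ((M.stateDist π s₀ t) s).toReal * M.R s (π s)

/-- A policy `ρ` is optimal for `M` if it dominates every policy at every state. -/
def Optimal (M : MDP S A) (ρ : S → A) : Prop :=
  ∀ (ρ' : S → A) (s : S), M.V ρ' s ≤ M.V ρ s

end MDP

section MMDP

variable {S : Type} [Fintype S] [Nonempty S]
variable {n : ℕ} {A : Fin n → Type} [∀ i, Fintype (A i)] [∀ i, Nonempty (A i)]

/-- A joint policy `(π₁,…,π_n)` regarded as a single policy over joint actions. -/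
def toPolicy (π : ∀ i, S → A i) : S → ∀ i, A i := fun s i => π i s

/-- The `i`-th self-absorbed projection `Π_i(M, π_{-i})`: the single agent MDP for
agent `i` when the other agents act according to `π_{-i}`. -/
noncomputable def proj (M : MDP S (∀ i, A i)) (i : Fin n) (π : ∀ j, S → A j) :
    MDP S (A i) where
  T := fun s a => M.T s (Function.update (fun j => π j s) i a)
  R := fun s a => M.R s (Function.update (fun j => π j s) i a)
  γ := M.γ
  γ_nonneg := M.γ_nonneg
  γ_lt_one := M.γ_lt_one

/-- Given that each projection has a unique optimal policy, the `i`-th best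
response operator replaces agent `i`'s policy by the optimal policy of
`Π_i(M, π_{-i})`. -/
noncomputable def BR (M : MDP S (∀ i, A i))
    (hU : ∀ (i : Fin n) (π : ∀ j, S → A j), ∃! ρ : S → A i, (proj M i π).Optimal ρ)
    (i : Fin n) (π : ∀ j, S → A j) : ∀ j, S → A j :=
  Function.update π i (hU i π).choose

/-- A joint policy `π` is a Nash equilibrium if no unilateral deviation of a single
agent can increase the value at any state. -/
def Nash (M : MDP S (∀ i, A i)) (π : ∀ j, S → A j) : Prop :=
  ∀ (i : Fin n) (π' : S → A i) (s : S),
    M.V (toPolicy (Function.update π i π')) s ≤ M.V (toPolicy π) s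

/-- The joint response operator `JR_σ = BR_{σ(n)} ∘ ⋯ ∘ BR_{σ(1)}`. -/
noncomputable def JR (M : MDP S (∀ i, A i))
    (hU : ∀ (i : Fin n) (π : ∀ j, S → A j), ∃! ρ : S → A i, (proj M i π).Optimal ρ)
    (σ : Equiv.Perm (Fin n)) (π : ∀ j, S → A j) : ∀ j, S → A j :=
  (List.finRange n).foldl (fun p k => BR M hU (σ k) p) π

end MMDP

theorem toPolicy_update {S : Type} {n : ℕ} {A : Fin n → Type} (π : ∀ j, S → A j)
    (i : Fin n) (ρ : S → A i) (s : S) :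
    toPolicy (Function.update π i ρ) s = Function.update (fun j => π j s) i (ρ s) := by
  funext j
  exact Function.apply_update (fun _ f => f s) π i ρ j

section MMDP

variable {S : Type} [Fintype S] [Nonempty S]
variable {n : ℕ} {A : Fin n → Type} [∀ i, Fintype (A i)] [∀ i, Nonempty (A i)]

/-- Running `ρ` in the projection induces the same state process as running the joint
policy in which agent `i` plays `ρ`. -/
theorem stateDist_proj (M : MDP S (∀ i, A i)) (i : Fin n) (π : ∀ j, S → A j) (ρ : S → A i)
    (s₀ : S) (t : ℕ) :
    (proj M i π).stateDist ρ s₀ t = M.stateDist (toPolicy (Function.update π i ρ)) s₀ t := by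
  induction t with
  | zero => rfl
  | succ t ih =>
    simp only [MDP.stateDist, ih, toPolicy_update]
    rfl

theorem V_proj (M : MDP S (∀ i, A i)) (i : Fin n) (π : ∀ j, S → A j) (ρ : S → A i) (s₀ : S) :
    (proj M i π).V ρ s₀ = M.V (toPolicy (Function.update π i ρ)) s₀ := by
  simp only [MDP.V, stateDist_proj, toPolicy_update]
  rfl

theorem V_le_V_BR (M : MDP S (∀ i, A i))
    (hU : ∀ (i : Fin n) (π : ∀ j, S → A j), ∃! ρ : S → A i, (proj M i π).Optimal ρ)
    (i : Fin n) (π : ∀ j, S → A j) (s : S) :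
    M.V (toPolicy π) s ≤ M.V (toPolicy (BR M hU i π)) s := by
  have h := (hU i π).choose_spec.1 (π i) s
  rwa [V_proj, V_proj, Function.update_eq_self] at h

theorem V_le_V_foldl_BR (M : MDP S (∀ i, A i))
    (hU : ∀ (i : Fin n) (π : ∀ j, S → A j), ∃! ρ : S → A i, (proj M i π).Optimal ρ)
    {ι : Type*} (f : ι → Fin n) (l : List ι) (π : ∀ j, S → A j) (s : S) :
    M.V (toPolicy π) s ≤ M.V (toPolicy (l.foldl (fun p k => BR M hU (f k) p) π)) s := by
  induction l generalizing π with
  | nil => exact le_rfl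
  | cons k l ih => exact (V_le_V_BR M hU (f k) π s).trans (ih _)

end MMDP

/-- Monotonicity of the joint response; Remark 1 generalized:
the joint response `JR_σ` weakly improves the value at every state; in particular
so does the composition `BR_i ∘ BR_j` for distinct agents `i ≠ j`. -/
theorem JR_weakly_improves
    {S : Type} [Fintype S] [Nonempty S] {n : ℕ} {A : Fin n → Type}
    [∀ i, Fintype (A i)] [∀ i, Nonempty (A i)]
    (M : MDP S (∀ i, A i))
    (hU : ∀ (i : Fin n) (π : ∀ j, S → A j), ∃! ρ : S → A i, (proj M i π).Optimal ρ)
    (σ : Equiv.Perm (Fin n)) :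
    (∀ (π : ∀ j, S → A j) (s : S),
        M.V (toPolicy (JR M hU σ π)) s ≥ M.V (toPolicy π) s) ∧
    (∀ (i j : Fin n), i ≠ j → ∀ (π : ∀ k, S → A k) (s : S),
        M.V (toPolicy (BR M hU i (BR M hU j π))) s ≥ M.V (toPolicy π) s) := by
  exact ⟨fun π s => V_le_V_foldl_BR M hU σ _ π s, fun i j _ π s =>
    (V_le_V_BR M hU j π s).trans (V_le_V_BR M hU i _ s)⟩
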